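/- arXiv:2202.06402 — 5 statements merged into one kernel-verified Lean document; each statement's English description precedes it below -/
import Mathlib

section
/- For all real numbers a and b, the function t ↦ log|2 sin t| is interval integrable (with respect to Lebesgue measure) on the interval from a to b; consequently the Lobachevsky function Λ(x) = −∫₀ˣ log|2 sin t| dt is well defined for every real x. -/
/-- The Lobachevsky function `Λ(x) = -∫₀ˣ log |2 sin t| dt`. -/
noncomputable def lobachevsky (x : ℝ) : ℝ :=
  -∫ t in (0:ℝ)..x, Real.log |2 * Real.sin t|

/-- The integrand `t ↦ log |2 sin t|` is interval integrable on any interval,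
so the Lobachevsky function is well defined. -/
theorem lobachevsky_integrand_intervalIntegrable (a b : ℝ) :
    IntervalIntegrable (fun t : ℝ => Real.log |2 * Real.sin t|)
      MeasureTheory.volume a b := by
  have hf : MeromorphicOn (fun t : ℝ => 2 * Real.sin t) (Set.uIcc a b) := by
    intro x _
    have h : AnalyticAt ℝ (fun t : ℝ => 2 * Real.sin t) x :=
      analyticAt_const.mul Real.analyticAt_sin
    exact h.meromorphicAt
  exact hf.intervalIntegrable_log_norm
end

section
/- The Lobachevsky function Λ(x) = −∫₀ˣ log|2 sin t| dt is continuous on all of ℝ (including at the integer multiples of π, where the integrand is singular). -/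
/-- The Lobachevsky function is continuous on all of `ℝ`. -/
theorem lobachevsky_continuous : Continuous lobachevsky := by
  have h : ∀ a b : ℝ, IntervalIntegrable (fun t => Real.log |2 * Real.sin t|)
      MeasureTheory.volume a b := by
    intro a b
    have hm : MeromorphicOn (fun t : ℝ => 2 * Real.sin t) (Set.uIcc a b) := by
      intro x _
      have : AnalyticAt ℝ (fun t : ℝ => 2 * Real.sin t) x :=
        analyticAt_const.mul Real.analyticAt_sin
      exact this.meromorphicAt
    have h1 := hm.intervalIntegrable_log
    simpa only [Function.comp_def, Real.log_abs] using h1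
  exact (intervalIntegral.continuous_primitive h 0).neg
end

section
/- At every real number x with sin x ≠ 0, the Lobachevsky function Λ is differentiable and its derivative equals −log|2 sin x|. -/
/-- At every point where `sin x ≠ 0`, the Lobachevsky function is differentiable
with derivative `-log |2 sin x|`. -/
theorem lobachevsky_hasDerivAt (x : ℝ) (hx : Real.sin x ≠ 0) :
    HasDerivAt lobachevsky (-Real.log |2 * Real.sin x|) x := by
  have hi : IntervalIntegrable (fun t => Real.log |2 * Real.sin t|) MeasureTheory.volume 0 x := by
    have hm : MeromorphicOn (fun t : ℝ => 2 * Real.sin t) (Set.uIcc 0 x) := by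
      intro t _
      have : AnalyticAt ℝ (fun t : ℝ => 2 * Real.sin t) t := by fun_prop
      exact this.meromorphicAt
    simpa [Real.norm_eq_abs] using hm.intervalIntegrable_log_norm
  have hmeas : Measurable (fun t => Real.log |2 * Real.sin t|) := by fun_prop
  have hc : ContinuousAt (fun t => Real.log |2 * Real.sin t|) x := by
    apply ContinuousAt.log
    · fun_prop
    · simpa using hx
  have h := (intervalIntegral.integral_hasDerivAt_right hi
    hmeas.stronglyMeasurable.stronglyMeasurableAtFilter hc).fun_neg
  have e : lobachevsky = fun u => -∫ t in (0:ℝ)..u, Real.log |2 * Real.sin t| := by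
    funext u
    rw [lobachevsky]
  rw [e]
  exact h
end

section
/- The function V(α, β, γ) = Λ(α) + Λ(β) + Λ(γ) is strictly concave on the convex set S = {(α, β, γ) ∈ ℝ³ : α > 0, β > 0, γ > 0, α + β + γ = π}. (That is, V is StrictConcaveOn the set S, even though Λ itself is not concave.) -/
lemma lob_hasDerivAt {x : ℝ} (h0 : 0 < x) (h1 : x < Real.pi) :
    HasDerivAt lobachevsky (-Real.log (2 * Real.sin x)) x := by
  have hs : 0 < Real.sin x := Real.sin_pos_of_pos_of_lt_pi h0 h1
  have he : lobachevsky = fun y => -∫ t in (0:ℝ)..y, Real.log (2 * Real.sin t) := by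
    funext y
    simp only [lobachevsky, Real.log_abs]
  rw [he]
  refine HasDerivAt.neg ?_
  refine intervalIntegral.integral_hasDerivAt_right ?_ ?_ ?_
  · have : MeromorphicOn (fun t : ℝ => 2 * Real.sin t) (Set.uIcc 0 x) := by
      intro t _
      have : AnalyticAt ℝ (fun t : ℝ => 2 * Real.sin t) t := by fun_prop
      exact this.meromorphicAt
    exact this.intervalIntegrable_log
  · exact (by fun_prop : Measurable fun t : ℝ => Real.log (2 * Real.sin t)).stronglyMeasurable.stronglyMeasurableAtFilter
  · exact ContinuousAt.log (by fun_prop) (by positivity)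

lemma cot_form_pos {a b c u v w : ℝ} (ha : 0 < a) (hb : 0 < b) (hc : 0 < c)
    (hs : a + b + c = Real.pi) (hu : u + v + w = 0) (hne : u ≠ 0 ∨ v ≠ 0) :
    0 < u ^ 2 * (Real.cos a / Real.sin a) + v ^ 2 * (Real.cos b / Real.sin b)
      + w ^ 2 * (Real.cos c / Real.sin c) := by
  have sa : 0 < Real.sin a := Real.sin_pos_of_pos_of_lt_pi ha (by linarith)
  have sb : 0 < Real.sin b := Real.sin_pos_of_pos_of_lt_pi hb (by linarith)
  have sc : 0 < Real.sin c := Real.sin_pos_of_pos_of_lt_pi hc (by linarith)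
  have hc' : c = Real.pi - (a + b) := by linarith
  have e1 : Real.sin c = Real.sin a * Real.cos b + Real.cos a * Real.sin b := by
    rw [hc', Real.sin_pi_sub, Real.sin_add]
  have e2 : Real.cos c = -(Real.cos a * Real.cos b - Real.sin a * Real.sin b) := by
    rw [hc', Real.cos_pi_sub, Real.cos_add]
  have hw : w = -(u + v) := by linarith
  have key : u ^ 2 * (Real.cos a / Real.sin a) + v ^ 2 * (Real.cos b / Real.sin b)
      + w ^ 2 * (Real.cos c / Real.sin c)
      = ((u * Real.cos a * Real.sin b - v * Real.cos b * Real.sin a) ^ 2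
        + ((u + v) * (Real.sin a * Real.sin b)) ^ 2)
        / (Real.sin a * Real.sin b * Real.sin c) := by
    rw [hw]
    field_simp
    rw [e1, e2]
    ring
  rw [key]
  refine div_pos ?_ (by positivity)
  by_cases h : u + v = 0
  · have hv : v = -u := by linarith
    have hu0 : u ≠ 0 := by
      rcases hne with h | h
      · exact h
      · intro h'; apply h; linarith
    have : u * Real.cos a * Real.sin b - v * Real.cos b * Real.sin a = u * Real.sin c := by
      rw [hv, e1]; ring
    rw [this]
    positivity
  · positivity

theorem strictConcaveOn_lobachevsky_volume :
    StrictConcaveOn ℝ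
      {p : ℝ × ℝ × ℝ | 0 < p.1 ∧ 0 < p.2.1 ∧ 0 < p.2.2 ∧ p.1 + p.2.1 + p.2.2 = Real.pi}
      (fun p : ℝ × ℝ × ℝ => lobachevsky p.1 + lobachevsky p.2.1 + lobachevsky p.2.2) := by
  have seg : ∀ x y t : ℝ, 0 < x → 0 < y → t ∈ Set.Icc (0:ℝ) 1 → 0 < x + t * (y - x) := by
    intro x y t hx hy ht
    rcases eq_or_lt_of_le ht.1 with h | h
    · rw [← h]; linarith
    · nlinarith [mul_pos h hy, mul_nonneg (sub_nonneg.2 ht.2) hx.le]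
  refine ⟨?_, ?_⟩
  · rintro ⟨a, b, c⟩ ⟨ha, hb, hc, hs⟩ ⟨a', b', c'⟩ ⟨ha', hb', hc', hs'⟩ s t hs0 ht0 hst
    have hs1 : s = 1 - t := by linarith
    have ht : t ∈ Set.Icc (0:ℝ) 1 := ⟨ht0, by linarith⟩
    simp only [] at ha hb hc hs ha' hb' hc' hs'
    simp only [Set.mem_ofPred_eq, Prod.smul_mk, Prod.mk_add_mk, smul_eq_mul]
    subst hs1
    refine ⟨by linarith [seg a a' t ha ha' ht], by linarith [seg b b' t hb hb' ht],
      by linarith [seg c c' t hc hc' ht], ?_⟩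
    linear_combination (1 - t) * hs + t * hs'
  · rintro ⟨a, b, c⟩ ⟨ha, hb, hc, hs⟩ ⟨a', b', c'⟩ ⟨ha', hb', hc', hs'⟩ hne s t hs0 ht0 hst
    simp only [] at ha hb hc hs ha' hb' hc' hs'
    have hs1 : s = 1 - t := by linarith
    subst hs1
    have hne' : a' - a ≠ 0 ∨ b' - b ≠ 0 := by
      by_contra! h
      apply hne
      have h1 : a = a' := by linarith [h.1]
      have h2 : b = b' := by linarith [h.2]
      have h3 : c = c' := by linarith
      rw [h1, h2, h3]
    have lin : ∀ x y r : ℝ, HasDerivAt (fun r : ℝ => x + r * (y - x)) (y - x) r := by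
      intro x y r
      simpa using ((hasDerivAt_id r).mul_const (y - x)).const_add x
    have sum : ∀ r : ℝ, (a + r * (a' - a)) + (b + r * (b' - b)) + (c + r * (c' - c)) = Real.pi := by
      intro r
      linear_combination (1 - r) * hs + r * hs'
    have bnd : ∀ r ∈ Set.Icc (0:ℝ) 1, (0 < a + r * (a' - a) ∧ a + r * (a' - a) < Real.pi) ∧
        (0 < b + r * (b' - b) ∧ b + r * (b' - b) < Real.pi) ∧
        (0 < c + r * (c' - c) ∧ c + r * (c' - c) < Real.pi) := by
      intro r hr
      have h1 := seg a a' r ha ha' hr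
      have h2 := seg b b' r hb hb' hr
      have h3 := seg c c' r hc hc' hr
      have h4 := sum r
      refine ⟨⟨h1, by linarith⟩, ⟨h2, by linarith⟩, ⟨h3, by linarith⟩⟩
    set g : ℝ → ℝ := fun r => lobachevsky (a + r * (a' - a)) + lobachevsky (b + r * (b' - b))
      + lobachevsky (c + r * (c' - c)) with hg
    set g' : ℝ → ℝ := fun r => -Real.log (2 * Real.sin (a + r * (a' - a))) * (a' - a)
      + -Real.log (2 * Real.sin (b + r * (b' - b))) * (b' - b)
      + -Real.log (2 * Real.sin (c + r * (c' - c))) * (c' - c) with hg'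
    have d1 : ∀ r ∈ Set.Icc (0:ℝ) 1, HasDerivAt g (g' r) r := by
      intro r hr
      obtain ⟨⟨h1, h2⟩, ⟨h3, h4⟩, ⟨h5, h6⟩⟩ := bnd r hr
      exact (((lob_hasDerivAt h1 h2).comp r (lin a a' r)).add
        ((lob_hasDerivAt h3 h4).comp r (lin b b' r))).add
        ((lob_hasDerivAt h5 h6).comp r (lin c c' r))
    have one : ∀ x y r : ℝ, 0 < x + r * (y - x) → x + r * (y - x) < Real.pi →
        HasDerivAt (fun r : ℝ => -Real.log (2 * Real.sin (x + r * (y - x))) * (y - x))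
          (-((y - x) ^ 2 * (Real.cos (x + r * (y - x)) / Real.sin (x + r * (y - x))))) r := by
      intro x y r h0 h1
      have hp := Real.sin_pos_of_pos_of_lt_pi h0 h1
      have := ((((lin x y r).sin.const_mul 2).log (by positivity)).neg).mul_const (y - x)
      refine this.congr_deriv ?_
      field_simp
    have d2 : ∀ r ∈ Set.Icc (0:ℝ) 1, ∃ d < 0, HasDerivAt g' d r := by
      intro r hr
      obtain ⟨⟨h1, h2⟩, ⟨h3, h4⟩, ⟨h5, h6⟩⟩ := bnd r hr
      refine ⟨_, ?_, ((one a a' r h1 h2).add (one b b' r h3 h4)).add (one c c' r h5 h6)⟩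
      have := cot_form_pos h1 h3 h5 (sum r)
        (by linarith : (a' - a) + (b' - b) + (c' - c) = 0) hne'
      linarith
    have anti : StrictAntiOn g' (Set.Icc 0 1) := by
      refine strictAntiOn_of_deriv_neg (convex_Icc 0 1) ?_ ?_
      · intro r hr
        obtain ⟨d, _, h⟩ := d2 r hr
        exact h.continuousAt.continuousWithinAt
      · intro r hr
        obtain ⟨d, hd, h⟩ := d2 r (interior_subset hr)
        rw [h.deriv]; exact hd
    have conc : StrictConcaveOn ℝ (Set.Icc (0:ℝ) 1) g := by
      refine StrictAntiOn.strictConcaveOn_of_deriv (convex_Icc 0 1)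
        (fun r hr => (d1 r hr).continuousAt.continuousWithinAt) ?_
      intro r hr q hq hrq
      rw [(d1 r (interior_subset hr)).deriv, (d1 q (interior_subset hq)).deriv]
      exact anti (interior_subset hr) (interior_subset hq) hrq
    have := conc.2 (Set.left_mem_Icc.2 zero_le_one) (Set.right_mem_Icc.2 zero_le_one)
      zero_ne_one hs0 ht0 hst
    have ex : ∀ x y : ℝ, (1 - t) * x + t * y = x + t * (y - x) := by intro x y; ring
    simp only [hg, smul_eq_mul, mul_zero, zero_add, mul_one, zero_mul, add_zero, one_mul,
      add_sub_cancel] at this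
    simp only [Prod.smul_mk, Prod.mk_add_mk, smul_eq_mul]
    rw [ex a a', ex b b', ex c c']
    exact this
end

section
/- Let A, B, C, D be four points in the Euclidean plane such that C and D lie strictly on opposite sides of the line through A and B (in particular A ≠ B and neither C nor D is on that line, so A, B, C are affinely independent and A, B, D are affinely independent). Then D lies strictly outside the circumscribed circle of the triangle ABC (i.e., the distance from D to the circumcenter of ABC is strictly greater than the circumradius of ABC) if and only if ∠ACB + ∠ADB < π, where ∠ACB and ∠ADB denote the unoriented angles at C and at D. -/
open EuclideanGeometry

lemma aux_sin_cos (A B C : EuclideanSpace ℝ (Fin 2)) (s p : ℝ)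
    (hs : s = (A 0 - C 0) * (B 1 - C 1) - (A 1 - C 1) * (B 0 - C 0))
    (hp : p = (A 0 - C 0) * (B 0 - C 0) + (A 1 - C 1) * (B 1 - C 1)) (h0 : s ≠ 0) :
    ∃ n : ℝ, 0 < n ∧ n * Real.cos (∠ A C B) = p ∧ n * Real.sin (∠ A C B) = |s| := by
  have hcos : Real.cos (∠ A C B) * (‖A - C‖ * ‖B - C‖) = p := by
    have := InnerProductGeometry.cos_angle_mul_norm_mul_norm (A - C) (B - C)
    rw [EuclideanGeometry.angle]
    simp only [vsub_eq_sub]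
    rw [this, hp]
    simp [PiLp.inner_apply, Fin.sum_univ_two]
    ring
  have hn : (‖A - C‖ * ‖B - C‖) ^ 2 = s ^ 2 + p ^ 2 := by
    rw [mul_pow, EuclideanSpace.norm_sq_eq, EuclideanSpace.norm_sq_eq]
    simp [Fin.sum_univ_two, hs, hp]
    ring
  have hnn : 0 ≤ ‖A - C‖ * ‖B - C‖ := by positivity
  generalize ‖A - C‖ * ‖B - C‖ = n at *
  have hnp : 0 < n := by
    rcases hnn.lt_or_eq with h | h
    · exact h
    · subst h
      have : 0 < s ^ 2 := by positivity
      nlinarith [sq_nonneg p]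
  refine ⟨n, hnp, by linarith, ?_⟩
  have h1 := InnerProductGeometry.sin_angle_nonneg (A -ᵥ C) (B -ᵥ C)
  change 0 ≤ Real.sin (∠ A C B) at h1
  rw [← abs_of_nonneg (mul_nonneg hnn h1)]
  rw [← sq_eq_sq_iff_abs_eq_abs]
  have := Real.sin_sq_add_cos_sq (∠ A C B)
  rw [← hcos] at hn
  linear_combination n ^ 2 * this + hn

lemma aux_mem (A B C : EuclideanSpace ℝ (Fin 2)) (hAB : A ≠ B)
    (hs : (A 0 - C 0) * (B 1 - C 1) - (A 1 - C 1) * (B 0 - C 0) = 0) :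
    C ∈ affineSpan ℝ {A, B} := by
  rw [mem_affineSpan_pair_iff_exists_lineMap_eq]
  have hd : (B 0 - A 0) ^ 2 + (B 1 - A 1) ^ 2 ≠ 0 := by
    intro h
    apply hAB
    ext i
    fin_cases i
    · show A 0 = B 0
      nlinarith [sq_nonneg (B 0 - A 0), sq_nonneg (B 1 - A 1)]
    · show A 1 = B 1
      nlinarith [sq_nonneg (B 0 - A 0), sq_nonneg (B 1 - A 1)]
  refine ⟨((C 0 - A 0) * (B 0 - A 0) + (C 1 - A 1) * (B 1 - A 1)) /
    ((B 0 - A 0) ^ 2 + (B 1 - A 1) ^ 2), ?_⟩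
  ext i
  fin_cases i
  · simp [AffineMap.lineMap_apply]
    field_simp
    linear_combination (B 1 - A 1) * hs
  · simp [AffineMap.lineMap_apply]
    field_simp
    linear_combination -(B 0 - A 0) * hs

lemma aux_angle (γ δ n m p q s t : ℝ) (hn : 0 < n) (hm : 0 < m)
    (hγ : 0 ≤ γ) (hγ' : γ ≤ Real.pi) (hδ : 0 ≤ δ) (hδ' : δ ≤ Real.pi)
    (h1 : n * Real.cos γ = p) (h2 : n * Real.sin γ = s)
    (h3 : m * Real.cos δ = q) (h4 : m * Real.sin δ = t) (hs : 0 < s) (ht : 0 < t) :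
    0 < s * q + p * t ↔ γ + δ < Real.pi := by
  have e : s * q + p * t = n * m * Real.sin (γ + δ) := by
    rw [Real.sin_add, ← h1, ← h2, ← h3, ← h4]; ring
  have hγ0 : 0 < γ := by
    rcases hγ.lt_or_eq with h | h
    · exact h
    · subst h; simp at h2; linarith
  rw [e, mul_pos_iff_of_pos_left (mul_pos hn hm)]
  constructor
  · intro h
    by_contra! hc
    have := Real.sin_nonneg_of_nonneg_of_le_pi (x := γ + δ - Real.pi) (by linarith) (by linarith)
    rw [Real.sin_sub_pi] at this
    linarith
  · intro h
    exact Real.sin_pos_of_pos_of_lt_pi (by linarith) h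

lemma aux_sign (s t p q x r₁ r₂ : ℝ) (hs0 : s ≠ 0) (hr₁ : 0 < r₁) (hr₂ : 0 < r₂)
    (hst : r₁ * s = - (r₂ * t)) (hpow : s * x = s * q - p * t) :
    |s| * x = |s| * q + p * |t| := by
  rcases lt_or_gt_of_ne hs0 with h | h
  · have ht : 0 < t := by
      by_contra! hc
      nlinarith [mul_pos hr₁ (neg_pos.2 h), mul_nonneg hr₂.le (neg_nonneg.2 hc)]
    rw [abs_of_neg h, abs_of_pos ht]; linarith
  · have ht : t < 0 := by
      by_contra! hc
      nlinarith [mul_pos hr₁ h, mul_nonneg hr₂.le hc]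
    rw [abs_of_pos h, abs_of_neg ht]; linarith

/-- For two triangles `ABC` and `ABD` in the Euclidean plane with `C` and `D` strictly on
opposite sides of the line `AB`, the point `D` is strictly outside the circumcircle of
`ABC` if and only if the opposite angles satisfy `∠ACB + ∠ADB < π`. -/
theorem dist_circumcenter_gt_circumradius_iff_angle_add_angle_lt_pi
    (A B C D : EuclideanSpace ℝ (Fin 2))
    (hABC : AffineIndependent ℝ ![A, B, C])
    (hABD : AffineIndependent ℝ ![A, B, D])
    (hside : (affineSpan ℝ {A, B}).SOppSide C D) :
    dist D (Affine.Simplex.circumcenter ⟨![A, B, C], hABC⟩ :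
        EuclideanSpace ℝ (Fin 2)) >
      Affine.Simplex.circumradius (⟨![A, B, C], hABC⟩ :
        Affine.Simplex ℝ (EuclideanSpace ℝ (Fin 2)) 2) ↔
    ∠ A C B + ∠ A D B < Real.pi := by
  have hAB : A ≠ B := by
    intro h
    have := hABC.injective.ne (show (0 : Fin 3) ≠ 1 by decide)
    simp [h] at this
  have hA := Affine.Simplex.dist_circumcenter_eq_circumradius
    (⟨![A, B, C], hABC⟩ : Affine.Simplex ℝ (EuclideanSpace ℝ (Fin 2)) 2) 0
  have hB := Affine.Simplex.dist_circumcenter_eq_circumradius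
    (⟨![A, B, C], hABC⟩ : Affine.Simplex ℝ (EuclideanSpace ℝ (Fin 2)) 2) 1
  have hC := Affine.Simplex.dist_circumcenter_eq_circumradius
    (⟨![A, B, C], hABC⟩ : Affine.Simplex ℝ (EuclideanSpace ℝ (Fin 2)) 2) 2
  have hR := Affine.Simplex.circumradius_nonneg
    (⟨![A, B, C], hABC⟩ : Affine.Simplex ℝ (EuclideanSpace ℝ (Fin 2)) 2)
  generalize (Affine.Simplex.circumcenter ⟨![A, B, C], hABC⟩ : EuclideanSpace ℝ (Fin 2)) = O at *
  generalize Affine.Simplex.circumradius (⟨![A, B, C], hABC⟩ :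
        Affine.Simplex ℝ (EuclideanSpace ℝ (Fin 2)) 2) = R at *
  change dist A O = R at hA
  change dist B O = R at hB
  change dist C O = R at hC
  have key : ∀ X : EuclideanSpace ℝ (Fin 2),
      dist X O ^ 2 = (X 0 - O 0) ^ 2 + (X 1 - O 1) ^ 2 := by
    intro X
    rw [EuclideanSpace.dist_sq_eq]
    simp [Fin.sum_univ_two, Real.dist_eq, sq_abs]
  have kA := key A
  have kB := key B
  have kC := key C
  have kD := key D
  rw [hA] at kA
  rw [hB] at kB
  rw [hC] at kC
  obtain ⟨s, hs⟩ : ∃ s, s = (A 0 - C 0) * (B 1 - C 1) - (A 1 - C 1) * (B 0 - C 0) := ⟨_, rfl⟩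
  obtain ⟨t, ht⟩ : ∃ t, t = (A 0 - D 0) * (B 1 - D 1) - (A 1 - D 1) * (B 0 - D 0) := ⟨_, rfl⟩
  obtain ⟨p, hp⟩ : ∃ p, p = (A 0 - C 0) * (B 0 - C 0) + (A 1 - C 1) * (B 1 - C 1) := ⟨_, rfl⟩
  obtain ⟨q, hq⟩ : ∃ q, q = (A 0 - D 0) * (B 0 - D 0) + (A 1 - D 1) * (B 1 - D 1) := ⟨_, rfl⟩
  rw [AffineSubspace.sOppSide_iff_exists_left (left_mem_affineSpan_pair ℝ A B)] at hside
  obtain ⟨hCn, hDn, P, hP, hray⟩ := hside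
  have hs0 : s ≠ 0 := fun h => hCn (aux_mem A B C hAB (hs ▸ h))
  have ht0 : t ≠ 0 := fun h => hDn (aux_mem A B D hAB (ht ▸ h))
  obtain ⟨r₁, r₂, hr₁, hr₂, hr⟩ : ∃ r₁ r₂ : ℝ, 0 < r₁ ∧ 0 < r₂ ∧
      r₁ • (C -ᵥ A) = r₂ • (P -ᵥ D) := by
    rcases hray with h | h | h
    · rw [vsub_eq_zero_iff_eq] at h
      exact absurd (h ▸ left_mem_affineSpan_pair ℝ A B) hCn
    · rw [vsub_eq_zero_iff_eq] at h
      exact absurd (h ▸ hP) hDn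
    · exact h
  rw [mem_affineSpan_pair_iff_exists_lineMap_eq] at hP
  obtain ⟨k, rfl⟩ := hP
  have e0 := congrArg (fun v : EuclideanSpace ℝ (Fin 2) => v 0) hr
  have e1 := congrArg (fun v : EuclideanSpace ℝ (Fin 2) => v 1) hr
  simp [AffineMap.lineMap_apply] at e0 e1
  have hst : r₁ * s = - (r₂ * t) := by
    rw [hs, ht]
    linear_combination -(B 1 - A 1) * e0 + (B 0 - A 0) * e1
  have hpow : s * (dist D O ^ 2 - R ^ 2) = s * q - p * t := by
    rw [kD]
    subst hs ht hp hq
    linear_combination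
      (-((A 0 - D 0) * (B 1 - D 1) - (A 1 - D 1) * (B 0 - D 0))) * kC
      - ((B 0 - D 0) * (C 1 - D 1) - (B 1 - D 1) * (C 0 - D 0)) * kA
      - ((C 0 - D 0) * (A 1 - D 1) - (C 1 - D 1) * (A 0 - D 0)) * kB
  obtain ⟨n, hn, hn1, hn2⟩ := aux_sin_cos A B C s p hs hp hs0
  obtain ⟨m, hm, hm1, hm2⟩ := aux_sin_cos A B D t q ht hq ht0
  have := aux_angle (∠ A C B) (∠ A D B) n m p q |s| |t| hn hm (angle_nonneg _ _ _)
    (angle_le_pi _ _ _) (angle_nonneg _ _ _) (angle_le_pi _ _ _) hn1 hn2 hm1 hm2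
    (abs_pos.2 hs0) (abs_pos.2 ht0)
  rw [← this]
  have hpow' : |s| * (dist D O ^ 2 - R ^ 2) = |s| * q + p * |t| :=
    aux_sign s t p q _ r₁ r₂ hs0 hr₁ hr₂ hst hpow
  rw [← hpow', mul_pos_iff_of_pos_left (abs_pos.2 hs0), sub_pos, gt_iff_lt,
    sq_lt_sq₀ hR dist_nonneg]
end
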